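/- Let α be real with 0 < α ≤ 1, let k ≥ 1 be a natural number, and let l : Fin k → ℝ satisfy 0 < l i ≤ 1 for all i and l (k-1) = 1 (the algorithm caches the last copies for the full window and no further request arrives). Then (2 + 2 * ∑ i, l i) / (2*α + 2 * ∑ i in Finset.range (k-1), min α (l i)) ≤ 2/α, with equality if and only if k = 1. Hence in the adversarial family of the lower-bound reduction the worst-case ratio over all deterministic caching-length choices equals exactly 2/α, attained by the single-request instance. -/

import Mathlib

theorem mul_lt_two_mul_min {a x : ℝ} (ha0 : 0 < a) (ha1 : a ≤ 1) (hx0 : 0 < x) (hx1 : x ≤ 1) :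
    a * x < 2 * min a x := by
  rcases min_cases a x with ⟨h, _⟩ | ⟨h, _⟩ <;> rw [h] <;> nlinarith

/-- In the adversarial family, the worst-case ratio over all deterministic
caching-length choices is at most 2/α, with equality exactly for k = 1. -/
theorem lower_bound_adversarial_family (alpha : ℝ) (halpha0 : 0 < alpha) (halpha1 : alpha ≤ 1)
    (k : ℕ) (hk : 1 ≤ k) (l : Fin k → ℝ)
    (hl : ∀ i, 0 < l i ∧ l i ≤ 1)
    (hlast : l ⟨k - 1, by omega⟩ = 1) :
    (2 + 2 * ∑ i, l i) /
        (2 * alpha +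
          2 * ∑ i ∈ Finset.univ.filter (fun i : Fin k => (i : ℕ) < k - 1), min alpha (l i))
      ≤ 2 / alpha ∧
    ((2 + 2 * ∑ i, l i) /
        (2 * alpha +
          2 * ∑ i ∈ Finset.univ.filter (fun i : Fin k => (i : ℕ) < k - 1), min alpha (l i))
      = 2 / alpha ↔ k = 1) := by
  have hsplit : ∑ i, l i =
      1 + ∑ i ∈ Finset.univ.filter (fun i : Fin k => (i : ℕ) < k - 1), l i := by
    have hcompl : Finset.univ.filter (fun i : Fin k => ¬ (i : ℕ) < k - 1) =
        {⟨k - 1, by omega⟩} := by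
      ext i
      simp only [Finset.mem_filter, Finset.mem_univ, true_and, Finset.mem_singleton, Fin.ext_iff]
      omega
    rw [← Finset.sum_filter_add_sum_filter_not Finset.univ (fun i : Fin k => (i : ℕ) < k - 1) l,
      hcompl, Finset.sum_singleton, hlast, add_comm]
  rw [hsplit]
  set s := Finset.univ.filter (fun i : Fin k => (i : ℕ) < k - 1) with hs
  have hterm : ∀ i ∈ s, alpha * l i < 2 * min alpha (l i) := fun i _ =>
    mul_lt_two_mul_min halpha0 halpha1 (hl i).1 (hl i).2
  have hmin : 0 ≤ ∑ i ∈ s, min alpha (l i) :=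
    Finset.sum_nonneg fun i _ => (lt_min halpha0 (hl i).1).le
  have hden : 0 < 2 * alpha + 2 * ∑ i ∈ s, min alpha (l i) := by positivity
  have hle : alpha * ∑ i ∈ s, l i ≤ 2 * ∑ i ∈ s, min alpha (l i) := by
    rw [Finset.mul_sum, Finset.mul_sum]
    exact Finset.sum_le_sum fun i hi => (hterm i hi).le
  refine ⟨?_, ?_⟩
  · rw [div_le_div_iff₀ hden halpha0]
    linarith
  · rw [div_eq_div_iff hden.ne' halpha0.ne']
    constructor
    · intro heq
      by_contra hk1
      have hne : s.Nonempty := ⟨⟨0, by omega⟩, by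
        simp only [hs, Finset.mem_filter, Finset.mem_univ, true_and]
        omega⟩
      have hlt : alpha * ∑ i ∈ s, l i < 2 * ∑ i ∈ s, min alpha (l i) := by
        rw [Finset.mul_sum, Finset.mul_sum]
        exact Finset.sum_lt_sum_of_nonempty hne hterm
      linarith
    · intro hk1
      have hempty : s = ∅ := by
        rw [hs, Finset.filter_eq_empty_iff]
        intro i _
        omega
      rw [hempty, Finset.sum_empty, Finset.sum_empty]
      ring
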